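/- arXiv:1304.2010 — 3 statements merged into one kernel-verified Lean document; each statement's English description precedes it below -/
import Mathlib

section
/- Assume cos θ ≠ 0. Then every nonzero eigenvalue μ of P_D A satisfies μ ≥ λ_min(Λ_⊥) − ε_D, where ε_D = λ_max(Λ_⊥)(sin θ + sin²θ) + ‖E⁻¹‖₂ (‖E‖₂ + λ_max(Λ_⊥))² tan²θ and tan θ = sin θ / cos θ. -/
open Matrix

/-- The Euclidean (2-)norm of a vector in `ℝ^k`. -/
noncomputable def euclNorm {k : ℕ} (x : Fin k → ℝ) : ℝ := Real.sqrt (∑ i, x i ^ 2)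

/-- The largest singular value of a real matrix:
`σ_max(M) = max_{‖x‖₂ = 1} ‖M x‖₂`.  For a square matrix this is the spectral
norm `‖M‖₂`. -/
noncomputable def sigmaMax {m k : ℕ} (M : Matrix (Fin m) (Fin k) ℝ) : ℝ :=
  sSup {c : ℝ | ∃ x : Fin k → ℝ, euclNorm x = 1 ∧ c = euclNorm (M.mulVec x)}

/-- The smallest singular value of a real matrix:
`σ_min(M) = min_{‖x‖₂ = 1} ‖M x‖₂`. -/
noncomputable def sigmaMin {m k : ℕ} (M : Matrix (Fin m) (Fin k) ℝ) : ℝ :=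
  sInf {c : ℝ | ∃ x : Fin k → ℝ, euclNorm x = 1 ∧ c = euclNorm (M.mulVec x)}

theorem euclNorm_eq_norm {k : ℕ} (x : Fin k → ℝ) : euclNorm x = ‖WithLp.toLp 2 x‖ := by
  simp [euclNorm, EuclideanSpace.norm_eq]

theorem euclNorm_nonneg {k : ℕ} (x : Fin k → ℝ) : 0 ≤ euclNorm x := Real.sqrt_nonneg _

theorem euclNorm_sq {k : ℕ} (x : Fin k → ℝ) : euclNorm x ^ 2 = x ⬝ᵥ x := by
  rw [euclNorm, Real.sq_sqrt (Finset.sum_nonneg fun i _ => sq_nonneg _)]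
  simp [dotProduct, sq]

theorem euclNorm_smul {k : ℕ} (c : ℝ) (x : Fin k → ℝ) :
    euclNorm (c • x) = |c| * euclNorm x := by
  simp [euclNorm_eq_norm, norm_smul]

theorem euclNorm_add_le {k : ℕ} (x y : Fin k → ℝ) :
    euclNorm (x + y) ≤ euclNorm x + euclNorm y := by
  simpa [euclNorm_eq_norm] using norm_add_le (WithLp.toLp 2 x) (WithLp.toLp 2 y)

theorem euclNorm_eq_zero {k : ℕ} {x : Fin k → ℝ} : euclNorm x = 0 ↔ x = 0 := by
  simp [euclNorm_eq_norm]

theorem dotProduct_le_euclNorm_mul {k : ℕ} (x y : Fin k → ℝ) :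
    x ⬝ᵥ y ≤ euclNorm x * euclNorm y := by
  apply le_of_sq_le_sq _ (mul_nonneg (euclNorm_nonneg x) (euclNorm_nonneg y))
  rw [mul_pow, euclNorm_sq, euclNorm_sq]
  simpa [dotProduct, sq] using Finset.sum_mul_sq_le_sq_mul_sq Finset.univ x y

theorem euclNorm_inv_smul {k : ℕ} {x : Fin k → ℝ} (hx : x ≠ 0) :
    euclNorm ((euclNorm x)⁻¹ • x) = 1 := by
  rw [euclNorm_smul, abs_of_nonneg (inv_nonneg.2 (euclNorm_nonneg x)),
    inv_mul_cancel₀ (euclNorm_eq_zero.not.2 hx)]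

theorem sigmaMax_nonneg {m k : ℕ} (M : Matrix (Fin m) (Fin k) ℝ) : 0 ≤ sigmaMax M :=
  Real.sSup_nonneg fun _ ⟨_, _, hc⟩ => hc ▸ euclNorm_nonneg _

theorem sigmaMin_nonneg {m k : ℕ} (M : Matrix (Fin m) (Fin k) ℝ) : 0 ≤ sigmaMin M :=
  Real.sInf_nonneg fun _ ⟨_, _, hc⟩ => hc ▸ euclNorm_nonneg _

theorem euclNorm_mulVec_le {m k : ℕ} (M : Matrix (Fin m) (Fin k) ℝ) (x : Fin k → ℝ) :
    euclNorm (M *ᵥ x) ≤ sigmaMax M * euclNorm x := by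
  rcases eq_or_ne x 0 with rfl | hx
  · simp [euclNorm]
  have hbdd : BddAbove {c : ℝ | ∃ x : Fin k → ℝ, euclNorm x = 1 ∧ c = euclNorm (M *ᵥ x)} := by
    refine ⟨‖(toLpLin 2 2 M).toContinuousLinearMap‖, ?_⟩
    rintro _ ⟨y, hy, rfl⟩
    have := (toLpLin 2 2 M).toContinuousLinearMap.le_opNorm (WithLp.toLp 2 y)
    rw [← euclNorm_eq_norm y, hy, mul_one] at this
    simpa [euclNorm_eq_norm] using this
  have h := le_csSup hbdd ⟨_, euclNorm_inv_smul hx, rfl⟩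
  have hpos : 0 < euclNorm x :=
    lt_of_le_of_ne (euclNorm_nonneg x) (Ne.symm (euclNorm_eq_zero.not.2 hx))
  rw [mulVec_smul, euclNorm_smul, abs_of_pos (inv_pos.2 hpos), inv_mul_le_iff₀ hpos] at h
  rwa [mul_comm]

theorem sigmaMin_mul_euclNorm_le {m k : ℕ} (M : Matrix (Fin m) (Fin k) ℝ) (x : Fin k → ℝ) :
    sigmaMin M * euclNorm x ≤ euclNorm (M *ᵥ x) := by
  rcases eq_or_ne x 0 with rfl | hx
  · simp [euclNorm]
  have hbdd : BddBelow {c : ℝ | ∃ x : Fin k → ℝ, euclNorm x = 1 ∧ c = euclNorm (M *ᵥ x)} :=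
    ⟨0, fun _ ⟨_, _, hc⟩ => hc ▸ euclNorm_nonneg _⟩
  have h := csInf_le hbdd ⟨_, euclNorm_inv_smul hx, rfl⟩
  have hpos : 0 < euclNorm x :=
    lt_of_le_of_ne (euclNorm_nonneg x) (Ne.symm (euclNorm_eq_zero.not.2 hx))
  rw [mulVec_smul, euclNorm_smul, abs_of_pos (inv_pos.2 hpos), le_inv_mul_iff₀ hpos] at h
  rwa [sigmaMin, mul_comm]

theorem isUnit_of_sigmaMin_ne_zero {k : ℕ} {C : Matrix (Fin k) (Fin k) ℝ}
    (hC : sigmaMin C ≠ 0) : IsUnit C := by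
  have hpos : 0 < sigmaMin C := lt_of_le_of_ne (sigmaMin_nonneg C) hC.symm
  refine mulVec_injective_iff_isUnit.1 ((injective_iff_map_eq_zero C.mulVecLin).2 fun x hx => ?_)
  have h := sigmaMin_mul_euclNorm_le C x
  rw [mulVecLin_apply] at hx
  rw [hx, euclNorm_eq_zero.2 rfl] at h
  exact euclNorm_eq_zero.1 (le_antisymm (nonpos_of_mul_nonpos_right h hpos) (euclNorm_nonneg x))

theorem dotProduct_mulVec_transpose {m k : ℕ} (M : Matrix (Fin m) (Fin k) ℝ)
    (x : Fin k → ℝ) (y : Fin m → ℝ) : (M *ᵥ x) ⬝ᵥ y = x ⬝ᵥ (Mᵀ *ᵥ y) := by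
  rw [dotProduct_mulVec, vecMul_transpose]

/-- For a matrix `[C S]` with orthonormal rows and `C` square invertible,
`σ_max(S)² + σ_min(C)² ≤ 1`. -/
theorem sigmaMax_sq_add_sigmaMin_sq_le {r s : ℕ} {C : Matrix (Fin r) (Fin r) ℝ}
    {S : Matrix (Fin r) (Fin s) ℝ} (hCS : C * Cᵀ + S * Sᵀ = 1) (hC : sigmaMin C ≠ 0) :
    sigmaMax S ^ 2 + sigmaMin C ^ 2 ≤ 1 := by
  have hpos : 0 < sigmaMin C := lt_of_le_of_ne (sigmaMin_nonneg C) hC.symm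
  have hrows (y : Fin r → ℝ) :
      euclNorm (Cᵀ *ᵥ y) ^ 2 + euclNorm (Sᵀ *ᵥ y) ^ 2 = euclNorm y ^ 2 := by
    simp only [euclNorm_sq, dotProduct_mulVec_transpose, transpose_transpose, mulVec_mulVec]
    rw [← dotProduct_add, ← add_mulVec, hCS, one_mulVec]
  have hCt (y : Fin r → ℝ) : sigmaMin C * euclNorm y ≤ euclNorm (Cᵀ *ᵥ y) := by
    obtain ⟨u, rfl⟩ := mulVec_surjective_iff_isUnit.2 (isUnit_of_sigmaMin_ne_zero hC) y
    have h1 := sigmaMin_mul_euclNorm_le C u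
    have h2 : euclNorm (C *ᵥ u) ^ 2 ≤ euclNorm u * euclNorm (Cᵀ *ᵥ (C *ᵥ u)) := by
      rw [euclNorm_sq, dotProduct_mulVec_transpose]
      exact dotProduct_le_euclNorm_mul _ _
    rcases (euclNorm_nonneg (C *ᵥ u)).eq_or_lt with h0 | h0
    · rw [← h0, mul_zero]; exact euclNorm_nonneg _
    · have h3 := euclNorm_nonneg (Cᵀ *ᵥ (C *ᵥ u))
      refine le_of_mul_le_mul_right ?_ h0
      nlinarith
  have hle_one : sigmaMin C ^ 2 ≤ 1 := by
    by_contra! h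
    have hr : ∃ x : Fin r → ℝ, euclNorm x = 1 := by
      by_contra! hne
      apply hC
      have : {c : ℝ | ∃ x : Fin r → ℝ, euclNorm x = 1 ∧ c = euclNorm (C *ᵥ x)} = ∅ := by
        ext c
        simpa using fun x hx => absurd hx (hne x)
      rw [sigmaMin, this, Real.sInf_empty]
    obtain ⟨x, hx⟩ := hr
    have h1 := hCt x
    have h2 := hrows x
    rw [hx] at h1 h2
    nlinarith [sq_nonneg (euclNorm (Sᵀ *ᵥ x))]
  have hS : sigmaMax S ≤ √(1 - sigmaMin C ^ 2) := by
    refine Real.sSup_le ?_ (Real.sqrt_nonneg _)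
    rintro _ ⟨z, hz, rfl⟩
    apply Real.le_sqrt_of_sq_le
    set y := S *ᵥ z with hy
    have h1 : euclNorm y ^ 2 ≤ euclNorm (Sᵀ *ᵥ y) := by
      rw [euclNorm_sq]
      nth_rw 1 [hy]
      rw [dotProduct_mulVec_transpose]
      simpa [hz] using dotProduct_le_euclNorm_mul z (Sᵀ *ᵥ y)
    rcases (euclNorm_nonneg y).eq_or_lt with h0 | h0
    · rw [← h0]; linarith
    · have h2 := hCt y
      have h3 := hrows y
      have h4 : (euclNorm y ^ 2) ^ 2 ≤ euclNorm (Sᵀ *ᵥ y) ^ 2 :=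
        pow_le_pow_left₀ (sq_nonneg _) h1 2
      have h5 : (sigmaMin C * euclNorm y) ^ 2 ≤ euclNorm (Cᵀ *ᵥ y) ^ 2 :=
        pow_le_pow_left₀ (mul_nonneg hpos.le h0.le) h2 2
      refine le_of_mul_le_mul_right ?_ (pow_pos h0 2)
      nlinarith
  have := pow_le_pow_left₀ (sigmaMax_nonneg S) hS 2
  rw [Real.sq_sqrt (by linarith)] at this
  linarith

theorem euclNorm_diagonal_mulVec_le {k : ℕ} {d : Fin k → ℝ} {c : ℝ} (h0 : ∀ i, 0 ≤ d i)
    (hc : ∀ i, d i ≤ c) (hc0 : 0 ≤ c) (x : Fin k → ℝ) :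
    euclNorm (diagonal d *ᵥ x) ≤ c * euclNorm x := by
  refine le_of_sq_le_sq ?_ (mul_nonneg hc0 (euclNorm_nonneg x))
  rw [mul_pow, euclNorm_sq, euclNorm_sq, dotProduct, dotProduct, Finset.mul_sum]
  refine Finset.sum_le_sum fun i _ => ?_
  rw [mulVec_diagonal]
  nlinarith [mul_le_mul_of_nonneg_right (pow_le_pow_left₀ (h0 i) (hc i) 2) (mul_self_nonneg (x i))]

theorem mul_euclNorm_sq_le_dotProduct_diagonal {k : ℕ} {d : Fin k → ℝ} {c : ℝ}
    (hc : ∀ i, c ≤ d i) (x : Fin k → ℝ) :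
    c * euclNorm x ^ 2 ≤ x ⬝ᵥ (diagonal d *ᵥ x) := by
  rw [euclNorm_sq, dotProduct, dotProduct, Finset.mul_sum]
  refine Finset.sum_le_sum fun i _ => ?_
  rw [mulVec_diagonal]
  nlinarith [mul_le_mul_of_nonneg_right (hc i) (mul_self_nonneg (x i))]

/-- The diagonal entries of a diagonalization of a positive definite matrix are positive. -/
theorem eigenvalue_pos_of_posDef {k : ℕ} {A U : Matrix (Fin k) (Fin k) ℝ} {lam : Fin k → ℝ}
    (hA : A.PosDef) (hU : Uᵀ * U = 1) (hAU : A * U = U * diagonal lam) (i : Fin k) :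
    0 < lam i := by
  have hUU : IsUnit U := (isUnit_iff_exists_inv').2 ⟨_, hU⟩
  have h := hA.conjTranspose_mul_mul_same (B := U) (mulVec_injective_iff_isUnit.2 hUU)
  rw [conjTranspose_eq_transpose_of_trivial, Matrix.mul_assoc, hAU, ← Matrix.mul_assoc, hU,
    Matrix.one_mul] at h
  simpa using h.diag_pos (i := i)

/-- A nonzero eigenvalue of the deflated matrix has a unit eigenvector orthogonal to the
deflation space, and equals its Rayleigh quotient. -/
theorem exists_unit_eigenvector_deflated {n r : ℕ} {A : Matrix (Fin n) (Fin n) ℝ}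
    {Z : Matrix (Fin n) (Fin r) ℝ} (hA : Aᵀ = A) (hE : IsUnit (Zᵀ * A * Z)) {μ : ℝ}
    (hμ : μ ∈ spectrum ℝ ((1 - A * Z * (Zᵀ * A * Z)⁻¹ * Zᵀ) * A)) (hμ0 : μ ≠ 0) :
    ∃ x : Fin n → ℝ, euclNorm x = 1 ∧ Zᵀ *ᵥ x = 0 ∧
      μ = x ⬝ᵥ (A *ᵥ x) -
        (Zᵀ *ᵥ (A *ᵥ x)) ⬝ᵥ ((Zᵀ * A * Z)⁻¹ *ᵥ (Zᵀ *ᵥ (A *ᵥ x))) := by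
  set E := Zᵀ * A * Z with hEdef
  set B := (1 - A * Z * E⁻¹ * Zᵀ) * A with hB
  rw [← spectrum_toLin', ← Module.End.hasEigenvalue_iff_mem_spectrum] at hμ
  obtain ⟨y, hy⟩ := hμ.exists_hasEigenvector
  have hBy : B *ᵥ y = μ • y := by simpa using hy.apply_eq_smul
  have hx := euclNorm_inv_smul hy.2
  have hBx : B *ᵥ ((euclNorm y)⁻¹ • y) = μ • ((euclNorm y)⁻¹ • y) := by
    rw [mulVec_smul, hBy, smul_comm]
  set x := (euclNorm y)⁻¹ • y
  have hZB : Zᵀ * B = 0 := by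
    have : Zᵀ * (A * Z * E⁻¹ * Zᵀ) = Zᵀ := by
      rw [← Matrix.mul_assoc, ← Matrix.mul_assoc, ← Matrix.mul_assoc, ← hEdef,
        mul_nonsing_inv _ ((isUnit_iff_isUnit_det E).1 hE), Matrix.one_mul]
    rw [hB, ← Matrix.mul_assoc, Matrix.mul_sub, this, Matrix.mul_one, sub_self, Matrix.zero_mul]
  refine ⟨x, hx, ?_, ?_⟩
  · have h : μ • (Zᵀ *ᵥ x) = 0 := by
      rw [← mulVec_smul, ← hBx, mulVec_mulVec, hZB, zero_mulVec]
    exact (smul_eq_zero.1 h).resolve_left hμ0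
  · have h : x ⬝ᵥ (B *ᵥ x) = μ := by
      rw [hBx, dotProduct_smul, ← euclNorm_sq, hx]; simp
    rw [← h, hB, Matrix.sub_mul, Matrix.one_mul, sub_mulVec, dotProduct_sub]
    congr 1
    simp only [dotProduct_mulVec_transpose, transpose_mul, transpose_transpose, hA, mulVec_mulVec,
      Matrix.mul_assoc]

/-- Same context as Statement 8, with `tan θ = sin θ / cos θ` and the
spectral norms `‖E‖₂ = σ_max(E)`, `‖E⁻¹‖₂ = σ_max(E⁻¹)`.  If `cos θ ≠ 0` then every
nonzero eigenvalue `μ` of `P_D A` satisfies `μ ≥ λ_min(Λ_⊥) − ε_D`, where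
`ε_D = λ_max(Λ_⊥)(sin θ + sin² θ) + ‖E⁻¹‖₂ (‖E‖₂ + λ_max(Λ_⊥))² tan² θ`. -/
theorem stmt_9 (r s : ℕ) (hr : 0 < r) (hs : 0 < s)
    (A : Matrix (Fin (r + s)) (Fin (r + s)) ℝ) (hA : A.PosDef)
    (lam : Fin (r + s) → ℝ) (U : Matrix (Fin (r + s)) (Fin (r + s)) ℝ)
    (hU : Uᵀ * U = 1) (hAU : A * U = U * Matrix.diagonal lam)
    (V : Matrix (Fin (r + s)) (Fin r) ℝ) (hV : V = U.submatrix id (Fin.castAdd s))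
    (Vp : Matrix (Fin (r + s)) (Fin s) ℝ) (hVp : Vp = U.submatrix id (Fin.natAdd r))
    (Z : Matrix (Fin (r + s)) (Fin r) ℝ) (hZ : Zᵀ * Z = 1)
    (sinθ : ℝ) (hsin : sinθ = sigmaMax (Zᵀ * Vp))
    (cosθ : ℝ) (hcos : cosθ = sigmaMin (Zᵀ * V)) (hcos0 : cosθ ≠ 0)
    (tanθ : ℝ) (htan : tanθ = sinθ / cosθ)
    (E : Matrix (Fin r) (Fin r) ℝ) (hE : E = Zᵀ * A * Z)
    (P : Matrix (Fin (r + s)) (Fin (r + s)) ℝ) (hP : P = 1 - A * Z * E⁻¹ * Zᵀ)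
    (lamMaxPerp : ℝ) (hlamMaxPerp : lamMaxPerp = ⨆ i : Fin s, lam (Fin.natAdd r i))
    (lamMinPerp : ℝ) (hlamMinPerp : lamMinPerp = ⨅ i : Fin s, lam (Fin.natAdd r i))
    (εD : ℝ)
    (hεD : εD = lamMaxPerp * (sinθ + sinθ ^ 2)
        + sigmaMax E⁻¹ * (sigmaMax E + lamMaxPerp) ^ 2 * tanθ ^ 2) :
    ∀ μ ∈ spectrum ℝ (P * A), μ ≠ 0 → lamMinPerp - εD ≤ μ := by
  intro μ hμ hμ0
  subst hE hP
  have hlam := eigenvalue_pos_of_posDef hA hU hAU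
  have hAt : Aᵀ = A := by
    simpa [conjTranspose_eq_transpose_of_trivial] using hA.isHermitian.eq
  have hZinj : Function.Injective Z.mulVec := fun x y h => by
    have := congrArg (Zᵀ *ᵥ ·) h
    simpa [mulVec_mulVec, hZ] using this
  have hE : IsUnit (Zᵀ * A * Z) := by
    have := hA.conjTranspose_mul_mul_same hZinj
    rw [conjTranspose_eq_transpose_of_trivial] at this
    exact this.isUnit
  have hVV : V * Vᵀ + Vp * Vpᵀ = 1 := by
    rw [← mul_eq_one_comm.1 hU]
    ext i j
    simp [hV, hVp, mul_apply, Fin.sum_univ_add]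
  have hVpVp : Vpᵀ * Vp = 1 := by
    ext i j
    have := congrFun₂ hU (Fin.natAdd r i) (Fin.natAdd r j)
    simpa [hVp, mul_apply, one_apply] using this
  have hAV : A * V = V * diagonal fun i => lam (Fin.castAdd s i) := by
    ext i j
    have := congrFun₂ hAU i (Fin.castAdd s j)
    rw [mul_diagonal] at this ⊢
    simpa [hV, mul_apply] using this
  have hAVp : A * Vp = Vp * diagonal fun i => lam (Fin.natAdd r i) := by
    ext i j
    have := congrFun₂ hAU i (Fin.natAdd r j)
    rw [mul_diagonal] at this ⊢
    simpa [hVp, mul_apply] using this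
  have hCS : (Zᵀ * V) * (Zᵀ * V)ᵀ + (Zᵀ * Vp) * (Zᵀ * Vp)ᵀ = 1 := by
    rw [← hZ]
    simp only [transpose_mul, transpose_transpose]
    calc _ = Zᵀ * (V * Vᵀ + Vp * Vpᵀ) * Z := by
          simp only [Matrix.mul_add, Matrix.add_mul, Matrix.mul_assoc]
      _ = _ := by rw [hVV, Matrix.mul_one]
  have hsc : sinθ ^ 2 + cosθ ^ 2 ≤ 1 := by
    rw [hsin, hcos]
    exact sigmaMax_sq_add_sigmaMin_sq_le hCS (hcos ▸ hcos0)
  have hsin0 : 0 ≤ sinθ := hsin ▸ sigmaMax_nonneg _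
  have hcospos : 0 < cosθ := lt_of_le_of_ne (hcos ▸ sigmaMin_nonneg _) hcos0.symm
  have hmin (i : Fin s) : lamMinPerp ≤ lam (Fin.natAdd r i) :=
    hlamMinPerp ▸ ciInf_le (Set.finite_range _).bddBelow i
  have hmax (i : Fin s) : lam (Fin.natAdd r i) ≤ lamMaxPerp :=
    hlamMaxPerp ▸ le_ciSup (f := fun i => lam (Fin.natAdd r i)) (Set.finite_range _).bddAbove i
  have hmin0 : 0 ≤ lamMinPerp := hlamMinPerp ▸ Real.iInf_nonneg fun i => (hlam _).le
  have hminmax : lamMinPerp ≤ lamMaxPerp := (hmin ⟨0, hs⟩).trans (hmax _)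
  have hmax0 : 0 ≤ lamMaxPerp := hmin0.trans hminmax
  obtain ⟨x, hx, hZx, hμx⟩ := exists_unit_eigenvector_deflated hAt hE hμ hμ0
  have hexpand (y : Fin (r + s) → ℝ) : y = V *ᵥ (Vᵀ *ᵥ y) + Vp *ᵥ (Vpᵀ *ᵥ y) := by
    rw [mulVec_mulVec, mulVec_mulVec, ← add_mulVec, hVV, one_mulVec]
  have hCunit : IsUnit (Zᵀ * V)ᵀ :=
    (isUnit_transpose _).2 (isUnit_of_sigmaMin_ne_zero (hcos ▸ hcos0))
  obtain ⟨t, ht⟩ := mulVec_surjective_iff_isUnit.2 hCunit (Vᵀ *ᵥ x)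
  rw [transpose_mul, transpose_transpose] at ht
  obtain ⟨w, hw⟩ : ∃ w, x = Z *ᵥ t + Vp *ᵥ w := by
    refine ⟨Vpᵀ *ᵥ (x - Z *ᵥ t), ?_⟩
    have h := hexpand (x - Z *ᵥ t)
    have h0 : Vᵀ *ᵥ (x - Z *ᵥ t) = 0 := by
      rw [mulVec_sub, mulVec_mulVec, ht, sub_self]
    rw [h0, mulVec_zero, zero_add] at h
    rw [← h]; abel
  have hSw : (Zᵀ * Vp) *ᵥ w = -t := by
    have h := congrArg (Zᵀ *ᵥ ·) hw
    simp only [hZx, mulVec_add, mulVec_mulVec, hZ, one_mulVec] at h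
    exact (neg_eq_of_add_eq_zero_right h.symm).symm
  have hT : euclNorm t ≤ sinθ * euclNorm w := by
    have h := euclNorm_mulVec_le (Zᵀ * Vp) w
    rw [hSw, ← hsin] at h
    simpa [euclNorm] using h
  set b := Vpᵀ *ᵥ x with hb
  have hbw : b ⬝ᵥ w = 1 := by
    have h : x ⬝ᵥ x = 1 := by rw [← euclNorm_sq, hx]; norm_num
    nth_rw 2 [hw] at h
    rw [dotProduct_add, dotProduct_comm x, dotProduct_comm x, dotProduct_mulVec_transpose,
      dotProduct_mulVec_transpose, hZx, dotProduct_zero, zero_add] at h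
    rwa [dotProduct_comm]
  have hW : euclNorm w ^ 2 = 1 + euclNorm t ^ 2 := by
    have hbeq : b = (Vpᵀ * Z) *ᵥ t + w := by
      rw [hb, hw]
      simp only [mulVec_add, mulVec_mulVec, hVpVp, one_mulVec]
    rw [hbeq, add_dotProduct, dotProduct_mulVec_transpose, transpose_mul, transpose_transpose,
      hSw, dotProduct_neg] at hbw
    rw [euclNorm_sq, euclNorm_sq]
    linarith
  have hBW : 1 ≤ euclNorm b * euclNorm w := hbw ▸ dotProduct_le_euclNorm_mul b w
  have hxAx : lamMinPerp * euclNorm b ^ 2 ≤ x ⬝ᵥ (A *ᵥ x) := by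
    have h : A *ᵥ x = V *ᵥ ((diagonal fun i => lam (Fin.castAdd s i)) *ᵥ (Vᵀ *ᵥ x)) +
        Vp *ᵥ ((diagonal fun i => lam (Fin.natAdd r i)) *ᵥ b) := by
      nth_rw 1 [hexpand x]
      simp only [mulVec_add, mulVec_mulVec, hb, ← hAV, ← hAVp, ← Matrix.mul_assoc]
    have h1 := mul_euclNorm_sq_le_dotProduct_diagonal hmin b
    have h2 := mul_euclNorm_sq_le_dotProduct_diagonal
      (fun i => (hlam (Fin.castAdd s i)).le) (Vᵀ *ᵥ x)
    rw [h, dotProduct_add, dotProduct_mulVec x V, dotProduct_mulVec x Vp, ← mulVec_transpose,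
      ← mulVec_transpose]
    linarith
  set g := Zᵀ *ᵥ (A *ᵥ x) with hg
  have hgle : euclNorm g ≤
      sigmaMax (Zᵀ * A * Z) * euclNorm t + sinθ * (lamMaxPerp * euclNorm w) := by
    have h : g = (Zᵀ * A * Z) *ᵥ t +
        (Zᵀ * Vp) *ᵥ ((diagonal fun i => lam (Fin.natAdd r i)) *ᵥ w) := by
      rw [hg, hw]
      simp only [mulVec_add, mulVec_mulVec, Matrix.mul_assoc, hAVp]
    rw [h]
    refine (euclNorm_add_le _ _).trans (add_le_add (euclNorm_mulVec_le _ _) ?_)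
    refine (euclNorm_mulVec_le _ _).trans ?_
    rw [← hsin]
    exact mul_le_mul_of_nonneg_left
      (euclNorm_diagonal_mulVec_le (fun i => (hlam _).le) hmax hmax0 w) hsin0
  have hquad : g ⬝ᵥ ((Zᵀ * A * Z)⁻¹ *ᵥ g) ≤ sigmaMax (Zᵀ * A * Z)⁻¹ * euclNorm g ^ 2 := by
    have h1 := dotProduct_le_euclNorm_mul g ((Zᵀ * A * Z)⁻¹ *ᵥ g)
    have h2 := mul_le_mul_of_nonneg_left (euclNorm_mulVec_le (Zᵀ * A * Z)⁻¹ g) (euclNorm_nonneg g)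
    linarith
  have hW0 := euclNorm_nonneg w
  have hT2 : euclNorm t ^ 2 ≤ sinθ ^ 2 * euclNorm w ^ 2 := by
    rw [← mul_pow]
    exact pow_le_pow_left₀ (euclNorm_nonneg t) hT 2
  have hWsin : euclNorm w ^ 2 * (1 - sinθ ^ 2) ≤ 1 := by linarith
  have hWcos : euclNorm w ≤ 1 / cosθ := by
    rw [le_div_iff₀ hcospos]
    refine le_of_sq_le_sq ?_ zero_le_one
    nlinarith [mul_le_mul_of_nonneg_left hsc (sq_nonneg (euclNorm w))]
  have hsW : sinθ * euclNorm w ≤ tanθ := by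
    rw [htan, div_eq_mul_one_div]
    exact mul_le_mul_of_nonneg_left hWcos hsin0
  have hB : 1 - sinθ ^ 2 ≤ euclNorm b ^ 2 := by
    have h1 : 1 ≤ euclNorm b ^ 2 * euclNorm w ^ 2 := by
      rw [← mul_pow]; exact one_le_pow₀ hBW
    have h2 : 0 ≤ 1 - sinθ ^ 2 := by nlinarith [sq_nonneg cosθ]
    have h3 := mul_le_mul_of_nonneg_left hWsin (sq_nonneg (euclNorm b))
    have h4 := mul_le_mul_of_nonneg_right h1 h2
    linarith
  have hgtan : euclNorm g ^ 2 ≤ (sigmaMax (Zᵀ * A * Z) + lamMaxPerp) ^ 2 * tanθ ^ 2 := by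
    rw [← mul_pow]
    refine pow_le_pow_left₀ (euclNorm_nonneg g) (hgle.trans ?_) 2
    have h1 := mul_le_mul_of_nonneg_left (hT.trans hsW) (sigmaMax_nonneg (Zᵀ * A * Z))
    have h2 := mul_le_mul_of_nonneg_left hsW hmax0
    linarith
  have h1 := mul_le_mul_of_nonneg_left hgtan (sigmaMax_nonneg (Zᵀ * A * Z)⁻¹)
  have h2 := mul_le_mul_of_nonneg_left hB hmin0
  have h3 := mul_le_mul_of_nonneg_right hminmax (sq_nonneg sinθ)
  have h4 := mul_nonneg hmax0 hsin0
  rw [hεD, hμx]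
  linarith
end

section
/- Let E = ZᵀAZ be invertible, P_D = I − A Z E⁻¹ Zᵀ and P_A = I − A Z E⁻¹ Zᵀ + Z E⁻¹ Zᵀ. Then the characteristic polynomials satisfy (X − 1)^r · charpoly(P_D A) = X^r · charpoly(P_A A); equivalently, the spectrum of P_A A (with algebraic multiplicity) is obtained from that of P_D A by replacing the r zero eigenvalues corresponding to the range of Z by r eigenvalues equal to 1. -/
open Matrix Polynomial

/-- If `M * B = 0`, the charpoly of `M + B` is the product of those of `M` and `B`,
up to the power of `X` given by the size. -/
theorem Matrix.X_pow_mul_charpoly_add_of_mul_eq_zero {R ι : Type*} [CommRing R] [Fintype ι]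
    [DecidableEq ι] {M B : Matrix ι ι R} (h : M * B = 0) :
    X ^ Fintype.card ι * (M + B).charpoly = M.charpoly * B.charpoly := by
  have hC : M.map (C : R →+* R[X]) * B.map (C : R →+* R[X]) = 0 := by
    rw [← Matrix.map_mul, h, Matrix.map_zero _ (map_zero C)]
  have key : (X : R[X]) • (M + B).charmatrix = M.charmatrix * B.charmatrix := by
    simp only [charmatrix, RingHom.mapMatrix_apply, Matrix.map_add _ (map_add C),
      Matrix.scalar_apply, ← Matrix.smul_one_eq_diagonal]
    rw [sub_mul, mul_sub, mul_sub, hC]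
    simp only [smul_mul_assoc, mul_smul_comm, one_mul, mul_one, smul_sub, smul_add]
    abel
  rw [charpoly, charpoly, charpoly, ← det_mul, ← key, det_smul]

/-- If `M * W = 0` and `V * W = 1`, adding `W * V` to `M` replaces zero eigenvalues of `M`
by ones. -/
theorem Matrix.X_sub_one_pow_mul_charpoly {R ι κ : Type*} [CommRing R] [Fintype ι]
    [DecidableEq ι] [Fintype κ] [DecidableEq κ] {M : Matrix ι ι R} {W : Matrix ι κ R}
    {V : Matrix κ ι R} (hMW : M * W = 0) (hVW : V * W = 1) :
    (X - 1) ^ Fintype.card κ * M.charpoly =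
      X ^ Fintype.card κ * (M + W * V).charpoly := by
  have hadd := X_pow_mul_charpoly_add_of_mul_eq_zero (M := M) (B := W * V) <| by
    rw [← Matrix.mul_assoc, hMW, Matrix.zero_mul]
  have hcomm := charpoly_mul_comm' W V
  rw [hVW, charpoly_one] at hcomm
  refine (isRegular_X_pow (Fintype.card ι)).left ?_
  linear_combination (-(X : R[X]) ^ Fintype.card κ) * hadd - M.charpoly * hcomm

/-- `A` is an `n × n` real symmetric positive definite matrix, `Z` an
`n × r` matrix with orthonormal columns, `E = Zᵀ A Z` invertible,
`P_D = I − A Z E⁻¹ Zᵀ` and `P_A = I − A Z E⁻¹ Zᵀ + Z E⁻¹ Zᵀ`.  Then the characteristic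
polynomials satisfy `(X − 1)^r · charpoly(P_D A) = X^r · charpoly(P_A A)`; i.e. the
spectrum of `P_A A` (with algebraic multiplicity) is obtained from that of `P_D A` by
replacing the `r` zero eigenvalues corresponding to the range of `Z` by `r` ones. -/
theorem stmt_10 (n r : ℕ) (hr : 0 < r) (hrn : r ≤ n)
    (A : Matrix (Fin n) (Fin n) ℝ) (hA : A.PosDef)
    (Z : Matrix (Fin n) (Fin r) ℝ) (hZ : Zᵀ * Z = 1)
    (E : Matrix (Fin r) (Fin r) ℝ) (hE : E = Zᵀ * A * Z) (hEunit : IsUnit E.det)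
    (PD : Matrix (Fin n) (Fin n) ℝ) (hPD : PD = 1 - A * Z * E⁻¹ * Zᵀ)
    (PA : Matrix (Fin n) (Fin n) ℝ) (hPA : PA = 1 - A * Z * E⁻¹ * Zᵀ + Z * E⁻¹ * Zᵀ) :
    (X - 1) ^ r * (PD * A).charpoly = X ^ r * (PA * A).charpoly := by
  have hMW : PD * A * (Z * E⁻¹) = 0 := by
    have hcancel : A * Z * E⁻¹ * (Zᵀ * A * Z) = A * Z := by
      rw [← hE, nonsing_inv_mul_cancel_right _ _ hEunit]
    have hMZ : PD * A * Z = 0 := by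
      rw [hPD, Matrix.sub_mul, Matrix.sub_mul, Matrix.one_mul, sub_eq_zero]
      simpa only [Matrix.mul_assoc] using hcancel.symm
    rw [← Matrix.mul_assoc, hMZ, Matrix.zero_mul]
  have hVW : Zᵀ * A * (Z * E⁻¹) = 1 := by
    rw [← Matrix.mul_assoc, ← hE, mul_nonsing_inv _ hEunit]
  have hPA' : PA * A = PD * A + Z * E⁻¹ * (Zᵀ * A) := by
    rw [hPA, hPD, Matrix.add_mul, Matrix.mul_assoc (Z * E⁻¹)]
  simpa only [hPA', Fintype.card_fin] using X_sub_one_pow_mul_charpoly hMW hVW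
end

section
/- Let Ẽ = VᵀAV, let H̃ be an invertible r×r real matrix, let P̄_A = I − A V H̃⁻¹ Vᵀ + V H̃⁻¹ Vᵀ, and set ρ₁ = Ẽ H̃⁻¹ − I and ρ₂ = H̃⁻¹ Ẽ − I. Then every real eigenvalue μ of P̄_A A satisfies min{1, λ_min(Λ_⊥)} − ξ_A ≤ μ ≤ max{1, λ_max(Λ_⊥)} + ξ_A, where ξ_A = ‖ρ₁‖₂ ‖Λ‖₂ + ‖ρ₂‖₂. -/
open Matrix

theorem euclNorm_pos {k : ℕ} {x : Fin k → ℝ} (hx : x ≠ 0) : 0 < euclNorm x := by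
  rw [euclNorm_eq_norm, norm_pos_iff]
  simpa using hx

theorem euclNorm_sub_le {k : ℕ} (x y : Fin k → ℝ) :
    euclNorm (x - y) ≤ euclNorm x + euclNorm y := by
  simpa only [euclNorm_eq_norm, WithLp.toLp_sub] using norm_sub_le _ _

theorem bddAbove_euclNorm_mulVec {m k : ℕ} (M : Matrix (Fin m) (Fin k) ℝ) :
    BddAbove {c : ℝ | ∃ x : Fin k → ℝ, euclNorm x = 1 ∧ c = euclNorm (M.mulVec x)} := by
  refine ⟨‖(Matrix.toLpLin 2 2 M).toContinuousLinearMap‖, ?_⟩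
  rintro _ ⟨x, hx, rfl⟩
  have h := (Matrix.toLpLin 2 2 M).toContinuousLinearMap.le_opNorm (WithLp.toLp 2 x)
  rw [euclNorm_eq_norm] at hx
  rw [hx, mul_one] at h
  simpa [euclNorm_eq_norm, Matrix.toLpLin_apply] using h

theorem exists_mulVec_eq_smul_of_mem_spectrum {n : ℕ} {M : Matrix (Fin n) (Fin n) ℝ} {μ : ℝ}
    (hμ : μ ∈ spectrum ℝ M) : ∃ x ≠ 0, M *ᵥ x = μ • x := by
  rw [spectrum.mem_iff, Matrix.isUnit_iff_isUnit_det, isUnit_iff_ne_zero, not_not,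
    ← Matrix.exists_mulVec_eq_zero_iff] at hμ
  obtain ⟨x, hx, h⟩ := hμ
  refine ⟨x, hx, ?_⟩
  rw [sub_mulVec, sub_eq_zero, Algebra.algebraMap_eq_smul_one, smul_mulVec, one_mulVec] at h
  exact h.symm

/-- An eigenvalue of `1 + R - S * L` differs from `1` by at most `‖S‖₂ ‖L‖₂ + ‖R‖₂`. -/
theorem abs_sub_one_le_of_mulVec_eq_smul {k : ℕ} {R S L : Matrix (Fin k) (Fin k) ℝ}
    {μ : ℝ} {y : Fin k → ℝ} (hy : y ≠ 0) (h : (1 + R - S * L) *ᵥ y = μ • y) :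
    |μ - 1| ≤ sigmaMax S * sigmaMax L + sigmaMax R := by
  have e : (μ - 1) • y = R *ᵥ y - S *ᵥ (L *ᵥ y) := by
    rw [sub_smul, ← h, sub_mulVec, add_mulVec, one_mulVec, one_smul, mulVec_mulVec]
    abel
  have hS := (euclNorm_mulVec_le S (L *ᵥ y)).trans
    (mul_le_mul_of_nonneg_left (euclNorm_mulVec_le L y) (sigmaMax_nonneg S))
  have hR := euclNorm_mulVec_le R y
  have hsub := euclNorm_sub_le (R *ᵥ y) (S *ᵥ (L *ᵥ y))
  rw [← e, euclNorm_smul] at hsub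
  refine le_of_mul_le_mul_right ?_ (euclNorm_pos hy)
  linarith

/-- Same context as Statement 15, but with
`P̄_A = I − A V H̃⁻¹ Vᵀ + V H̃⁻¹ Vᵀ`, `ρ₁ = Ẽ H̃⁻¹ − I` and `ρ₂ = H̃⁻¹ Ẽ − I`.  Then
every real eigenvalue `μ` of `P̄_A A` satisfies
`min{1, λ_min(Λ_⊥)} − ξ_A ≤ μ ≤ max{1, λ_max(Λ_⊥)} + ξ_A` with
`ξ_A = ‖ρ₁‖₂ ‖Λ‖₂ + ‖ρ₂‖₂`. -/
theorem stmt_17 (r s : ℕ) (hr : 0 < r) (hs : 0 < s)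
    (A : Matrix (Fin (r + s)) (Fin (r + s)) ℝ) (hA : A.PosDef)
    (lam : Fin (r + s) → ℝ) (U : Matrix (Fin (r + s)) (Fin (r + s)) ℝ)
    (hU : Uᵀ * U = 1) (hAU : A * U = U * Matrix.diagonal lam)
    (V : Matrix (Fin (r + s)) (Fin r) ℝ) (hV : V = U.submatrix id (Fin.castAdd s))
    (Lam : Matrix (Fin r) (Fin r) ℝ)
    (hLam : Lam = Matrix.diagonal fun i => lam (Fin.castAdd s i))
    (Et : Matrix (Fin r) (Fin r) ℝ) (hEt : Et = Vᵀ * A * V)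
    (H : Matrix (Fin r) (Fin r) ℝ) (hH : IsUnit H.det)
    (P : Matrix (Fin (r + s)) (Fin (r + s)) ℝ)
    (hP : P = 1 - A * V * H⁻¹ * Vᵀ + V * H⁻¹ * Vᵀ)
    (ρ₁ : Matrix (Fin r) (Fin r) ℝ) (hρ₁ : ρ₁ = Et * H⁻¹ - 1)
    (ρ₂ : Matrix (Fin r) (Fin r) ℝ) (hρ₂ : ρ₂ = H⁻¹ * Et - 1)
    (lamMaxPerp : ℝ) (hlamMaxPerp : lamMaxPerp = ⨆ i : Fin s, lam (Fin.natAdd r i))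
    (lamMinPerp : ℝ) (hlamMinPerp : lamMinPerp = ⨅ i : Fin s, lam (Fin.natAdd r i))
    (ξA : ℝ) (hξA : ξA = sigmaMax ρ₁ * sigmaMax Lam + sigmaMax ρ₂) :
    ∀ μ ∈ spectrum ℝ (P * A),
      min 1 lamMinPerp - ξA ≤ μ ∧ μ ≤ max 1 lamMaxPerp + ξA := by
  intro μ hμ
  obtain ⟨x, hx, hPx⟩ := exists_mulVec_eq_smul_of_mem_spectrum hμ
  have hξ : 0 ≤ ξA := by
    rw [hξA]
    exact add_nonneg (mul_nonneg (sigmaMax_nonneg _) (sigmaMax_nonneg _)) (sigmaMax_nonneg _)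
  have hAT : Aᵀ = A := by simpa using hA.isHermitian.eq
  have hUA : Uᵀ * A = Matrix.diagonal lam * Uᵀ := by
    simpa [Matrix.transpose_mul, hAT] using congrArg Matrix.transpose hAU
  have hUdet : IsUnit Uᵀ.det := isUnit_det_of_right_inverse hU
  set W := U.submatrix id (Fin.natAdd r) with hW
  have hAV : A * V = V * Lam := by
    ext i j
    simpa [hV, hLam, Matrix.mul_apply, Matrix.diagonal_apply] using
      congrFun (congrFun hAU i) (Fin.castAdd s j)
  have hVA : Vᵀ * A = Lam * Vᵀ := by
    have hLT : Lamᵀ = Lam := by rw [hLam, diagonal_transpose]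
    simpa [Matrix.transpose_mul, hAT, hLT] using congrArg Matrix.transpose hAV
  have hWA : Wᵀ * A = Matrix.diagonal (fun i => lam (Fin.natAdd r i)) * Wᵀ := by
    ext i j
    simpa [hW, Matrix.mul_apply, Matrix.diagonal_apply] using
      congrFun (congrFun hUA (Fin.natAdd r i)) j
  have hVV : Vᵀ * V = 1 := by
    ext i j
    simpa [hV, Matrix.mul_apply, Matrix.one_apply] using
      congrFun (congrFun hU (Fin.castAdd s i)) (Fin.castAdd s j)
  have hWV : Wᵀ * V = 0 := by
    ext i j
    have hne : Fin.natAdd r i ≠ Fin.castAdd s j := by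
      simp only [ne_eq, Fin.ext_iff, Fin.val_natAdd, Fin.val_castAdd]
      omega
    simpa [hV, hW, Matrix.mul_apply, Matrix.one_apply, hne] using
      congrFun (congrFun hU (Fin.natAdd r i)) (Fin.castAdd s j)
  have hEL : Et = Lam := by rw [hEt, Matrix.mul_assoc, hAV, ← Matrix.mul_assoc, hVV, one_mul]
  have hPV : Vᵀ * (P * A) = (1 + ρ₂ - ρ₁ * Lam) * Vᵀ := by
    have e : Vᵀ * P = Vᵀ - Lam * H⁻¹ * Vᵀ + H⁻¹ * Vᵀ := by
      rw [hP, hAV]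
      simp only [Matrix.mul_add, Matrix.mul_sub, ← Matrix.mul_assoc, hVV, Matrix.one_mul,
        Matrix.mul_one]
    rw [← Matrix.mul_assoc, e, hρ₁, hρ₂, hEL]
    simp only [Matrix.add_mul, Matrix.sub_mul, Matrix.mul_assoc, hVA, Matrix.one_mul]
    abel
  have hPW : Wᵀ * (P * A) = Matrix.diagonal (fun i => lam (Fin.natAdd r i)) * Wᵀ := by
    have e : Wᵀ * P = Wᵀ := by
      rw [hP, hAV]
      simp only [Matrix.mul_add, Matrix.mul_sub, ← Matrix.mul_assoc, hWV, Matrix.zero_mul,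
        Matrix.mul_one, sub_zero, add_zero]
    rw [← Matrix.mul_assoc, e, hWA]
  by_cases hVx : Vᵀ *ᵥ x = 0
  · obtain ⟨j, hj⟩ : ∃ j, (Wᵀ *ᵥ x) j ≠ 0 := by
      by_contra! hWx
      refine hx (Matrix.mulVec_injective_of_isUnit ((Matrix.isUnit_iff_isUnit_det _).2 hUdet) ?_)
      rw [mulVec_zero]
      funext i
      refine Fin.addCases (fun i => ?_) (fun i => ?_) i
      · simpa [hV, Matrix.mulVec, dotProduct] using congrFun hVx i
      · simpa [hW, Matrix.mulVec, dotProduct] using hWx i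
    have h := congrArg (Wᵀ *ᵥ ·) hPx
    simp only [mulVec_mulVec, hPW, mulVec_smul] at h
    have h' := congrFun h j
    rw [← mulVec_mulVec, mulVec_diagonal, Pi.smul_apply, smul_eq_mul] at h'
    have hμj : lam (Fin.natAdd r j) = μ := mul_right_cancel₀ hj h'
    have hmin : lamMinPerp ≤ μ := by
      rw [hlamMinPerp, ← hμj]
      exact ciInf_le (Set.finite_range _).bddBelow j
    have hmax : μ ≤ lamMaxPerp := by
      rw [hlamMaxPerp, ← hμj]
      exact le_ciSup (f := fun i : Fin s => lam (Fin.natAdd r i)) (Set.finite_range _).bddAbove j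
    constructor
    · linarith [min_le_right 1 lamMinPerp]
    · linarith [le_max_right 1 lamMaxPerp]
  · have h := congrArg (Vᵀ *ᵥ ·) hPx
    simp only [mulVec_mulVec, hPV, mulVec_smul] at h
    rw [← mulVec_mulVec] at h
    have hb := abs_le.1 (abs_sub_one_le_of_mulVec_eq_smul hVx h)
    rw [← hξA] at hb
    constructor
    · linarith [min_le_left 1 lamMinPerp, hb.1]
    · linarith [le_max_left 1 lamMaxPerp, hb.2]
end
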